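/- Let Z be a separable infinite-dimensional Banach space and A a bounded linear operator on Z. Suppose there exists an A-invariant Borel probability measure ν on Z with full support (ν(U) > 0 for every nonempty open U ⊆ Z) such that A is ergodic with respect to ν. Then ν-almost every vector z ∈ Z is frequently hypercyclic for A: for every nonempty open subset V of Z, the set {n ≥ 0 : A^n z ∈ V} has positive lower density, i.e. liminf_{N→∞} #{0 ≤ n < N : A^n z ∈ V}/N > 0. -/

import Mathlib

open MeasureTheory Filter Topology

section MaximalErgodic

variable {α : Type*} {T : α → α} {g : α → ℝ}

/-- The maximum of the Birkhoff sums of `g` over at most `N` steps, the empty sum included. -/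
def birkhoffMax (T : α → α) (g : α → ℝ) : ℕ → α → ℝ
  | 0, _ => 0
  | N + 1, x => max 0 (g x + birkhoffMax T g N (T x))

lemma birkhoffMax_nonneg (N : ℕ) (x : α) : 0 ≤ birkhoffMax T g N x := by
  cases N with
  | zero => exact le_rfl
  | succ N => exact le_max_left _ _

lemma birkhoffMax_le_succ (N : ℕ) (x : α) : birkhoffMax T g N x ≤ birkhoffMax T g (N + 1) x := by
  induction N generalizing x with
  | zero => exact birkhoffMax_nonneg 1 x
  | succ N ih => exact max_le_max le_rfl (by gcongr; exact ih _)

lemma monotone_birkhoffMax (x : α) : Monotone fun N => birkhoffMax T g N x :=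
  monotone_nat_of_le_succ fun N => birkhoffMax_le_succ N x

lemma birkhoffSum_le_birkhoffMax (N : ℕ) (x : α) :
    birkhoffSum T g N x ≤ birkhoffMax T g N x := by
  induction N generalizing x with
  | zero => simp [birkhoffMax]
  | succ N ih =>
    rw [birkhoffSum_succ']
    exact le_max_of_le_right (by gcongr; exact ih _)

lemma birkhoffMax_le_add_of_pos {N : ℕ} {x : α} (h : 0 < birkhoffMax T g N x) :
    birkhoffMax T g N x ≤ g x + birkhoffMax T g N (T x) := by
  cases N with
  | zero => exact absurd h (lt_irrefl _)
  | succ N =>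
    have h' : birkhoffMax T g (N + 1) x = g x + birkhoffMax T g N (T x) :=
      max_eq_right ((lt_max_iff.mp h).resolve_left (lt_irrefl _)).le
    rw [h']
    gcongr
    exact birkhoffMax_le_succ N _

variable [MeasurableSpace α] {μ : Measure α}

lemma measurable_birkhoffSum (hT : Measurable T) (hg : Measurable g) (N : ℕ) :
    Measurable (birkhoffSum T g N) :=
  Finset.measurable_fun_sum _ fun n _ => hg.comp (hT.iterate n)

lemma measurable_birkhoffMax (hT : Measurable T) (hg : Measurable g) (N : ℕ) :
    Measurable (birkhoffMax T g N) := by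
  induction N with
  | zero => exact measurable_const
  | succ N ih => exact measurable_const.max (hg.add (ih.comp hT))

lemma integrable_birkhoffMax (hT : MeasurePreserving T μ μ) (hg : Integrable g μ) (N : ℕ) :
    Integrable (birkhoffMax T g N) μ := by
  induction N with
  | zero => exact integrable_zero _ _ _
  | succ N ih => exact (integrable_zero _ _ _).sup (hg.add (hT.integrable_comp_of_integrable ih))

lemma setIntegral_birkhoffMax_pos_nonneg (hT : MeasurePreserving T μ μ) (hgm : Measurable g)
    (hg : Integrable g μ) (N : ℕ) : 0 ≤ ∫ x in {x | 0 < birkhoffMax T g N x}, g x ∂μ := by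
  have hM := integrable_birkhoffMax hT hg N
  have hMm := measurable_birkhoffMax hT.measurable hgm N
  have hMT : Integrable (fun x => birkhoffMax T g N (T x)) μ :=
    hT.integrable_comp_of_integrable hM
  have hs : MeasurableSet {x | 0 < birkhoffMax T g N x} := measurableSet_lt measurable_const hMm
  have hcomp : ∫ x, birkhoffMax T g N (T x) ∂μ = ∫ x, birkhoffMax T g N x ∂μ := by
    have h := integral_map hT.measurable.aemeasurable
      (hMm.aestronglyMeasurable (μ := μ.map T))
    rw [hT.map_eq] at h
    exact h.symm
  rw [← integral_indicator hs]
  calc (0 : ℝ) = ∫ x, (birkhoffMax T g N x - birkhoffMax T g N (T x)) ∂μ := by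
        rw [integral_sub hM hMT, hcomp, sub_self]
    _ ≤ _ := by
        refine integral_mono (hM.sub hMT) (hg.indicator hs) fun x => ?_
        by_cases hx : 0 < birkhoffMax T g N x
        · rw [Set.indicator_of_mem (by exact hx)]
          linarith [birkhoffMax_le_add_of_pos hx]
        · rw [Set.indicator_of_notMem (by exact hx)]
          linarith [birkhoffMax_nonneg (T := T) (g := g) N (T x)]

/-- A form of the maximal ergodic theorem. -/
theorem integral_nonneg_of_ae_exists_birkhoffSum_pos (hT : MeasurePreserving T μ μ)
    (hgm : Measurable g) (hg : Integrable g μ) (h : ∀ᵐ x ∂μ, ∃ N, 0 < birkhoffSum T g N x) :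
    0 ≤ ∫ x, g x ∂μ := by
  have hlim := tendsto_setIntegral_of_monotone (μ := μ) (f := g)
    (s := fun N => {x | 0 < birkhoffMax T g N x})
    (fun N => measurableSet_lt measurable_const (measurable_birkhoffMax hT.measurable hgm N))
    (fun m n hmn x hx => lt_of_lt_of_le hx (monotone_birkhoffMax x hmn)) hg.integrableOn
  have huniv : (⋃ N, {x | 0 < birkhoffMax T g N x}) =ᵐ[μ] Set.univ := by
    rw [eventuallyEq_univ]
    filter_upwards [h] with x ⟨N, hN⟩
    exact Set.mem_iUnion.mpr ⟨N, hN.trans_le (birkhoffSum_le_birkhoffMax N x)⟩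
  rw [setIntegral_congr_set huniv, setIntegral_univ] at hlim
  exact ge_of_tendsto' hlim fun N => setIntegral_birkhoffMax_pos_nonneg hT hgm hg N

end MaximalErgodic

section Visits

variable {α : Type*} {T : α → α} {V : Set α}

/-- The points whose orbit visits `V` with positive lower frequency. -/
def frequentVisitors (T : α → α) (V : Set α) : Set α :=
  {x | ∃ k : ℕ, ∃ N₀ : ℕ, ∀ N ≥ N₀, (N : ℝ) ≤ (k + 1) * birkhoffSum T (V.indicator 1) N x}

lemma birkhoffSum_indicator_one (N : ℕ) (x : α) :
    birkhoffSum T (V.indicator (1 : α → ℝ)) N x = {n : ℕ | n < N ∧ T^[n] x ∈ V}.ncard := by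
  classical
  have h : {n : ℕ | n < N ∧ T^[n] x ∈ V} = ↑((Finset.range N).filter fun n => T^[n] x ∈ V) := by
    ext n; simp
  rw [h, Set.ncard_coe_finset, birkhoffSum]
  simp [Set.indicator_apply]

lemma preimage_frequentVisitors : T ⁻¹' frequentVisitors T V = frequentVisitors T V := by
  have h0 (x : α) : 0 ≤ V.indicator (1 : α → ℝ) x := Set.indicator_nonneg (by simp) x
  have h1 (x : α) : V.indicator (1 : α → ℝ) x ≤ 1 := Set.indicator_le_self' (by simp) x
  ext x
  constructor
  · rintro ⟨k, N₀, h⟩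
    refine ⟨k + 1, N₀ + k + 2, fun N hN => ?_⟩
    obtain ⟨m, rfl⟩ : ∃ m, N = m + 1 := ⟨N - 1, by omega⟩
    have hm := h m (by omega)
    have hkm : (k : ℝ) + 1 ≤ m := by exact_mod_cast (by omega : k + 1 ≤ m)
    have hk : (0 : ℝ) ≤ k := k.cast_nonneg
    rw [birkhoffSum_succ']
    have hS : 1 ≤ birkhoffSum T (V.indicator (1 : α → ℝ)) m (T x) := by
      by_contra! hlt
      nlinarith
    push_cast
    nlinarith [h0 x]
  · rintro ⟨k, N₀, h⟩
    refine ⟨2 * k + 1, N₀ + 2 * k + 2, fun N hN => ?_⟩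
    have hm := h (N + 1) (by omega)
    have hkm : 2 * (k : ℝ) + 2 ≤ N := by exact_mod_cast (by omega : 2 * k + 2 ≤ N)
    rw [birkhoffSum_succ'] at hm
    push_cast at hm ⊢
    nlinarith [mul_le_mul_of_nonneg_left (h1 x) (by positivity : (0 : ℝ) ≤ k + 1)]

lemma liminf_visits_pos_of_mem_frequentVisitors {U : Set α} (hVU : V ⊆ U) {x : α}
    (hx : x ∈ frequentVisitors T V) :
    0 < atTop.liminf (fun N : ℕ => ({n : ℕ | n < N ∧ T^[n] x ∈ U}.ncard : ℝ) / N) := by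
  obtain ⟨k, N₀, h⟩ := hx
  have hfin (N : ℕ) (W : Set α) : {n : ℕ | n < N ∧ T^[n] x ∈ W} ⊆ Set.Iio N := fun n hn => hn.1
  refine lt_of_lt_of_le (by positivity : (0 : ℝ) < 1 / (k + 1)) (le_liminf_of_le ?_ ?_)
  · refine IsBoundedUnder.isCoboundedUnder_ge ⟨1, eventually_map.mpr (.of_forall fun N => ?_)⟩
    refine div_le_one_of_le₀ ?_ N.cast_nonneg
    have := Set.ncard_le_ncard (hfin N U) (Set.finite_Iio N)
    rw [← Finset.coe_Iio, Set.ncard_coe_finset, Nat.card_Iio] at this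
    exact_mod_cast this
  · filter_upwards [eventually_ge_atTop N₀, eventually_gt_atTop 0] with N hN hN0
    have hle : {n : ℕ | n < N ∧ T^[n] x ∈ V}.ncard ≤ {n : ℕ | n < N ∧ T^[n] x ∈ U}.ncard :=
      Set.ncard_le_ncard (fun n hn => ⟨hn.1, hVU hn.2⟩) ((Set.finite_Iio N).subset (hfin N U))
    have hle' : ({n : ℕ | n < N ∧ T^[n] x ∈ V}.ncard : ℝ)
        ≤ {n : ℕ | n < N ∧ T^[n] x ∈ U}.ncard := by exact_mod_cast hle
    have hN' := h N hN
    rw [birkhoffSum_indicator_one] at hN'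
    rw [div_le_div_iff₀ (by positivity) (by exact_mod_cast hN0), one_mul, mul_comm]
    exact hN'.trans (by gcongr)

variable [MeasurableSpace α] {μ : Measure α}

lemma measurableSet_frequentVisitors (hT : Measurable T) (hV : MeasurableSet V) :
    MeasurableSet (frequentVisitors T V) := by
  simp only [frequentVisitors, Set.ofPred_exists, Set.ofPred_forall]
  refine .iUnion fun k => .iUnion fun N₀ => .iInter fun N => .iInter fun _ => ?_
  exact measurableSet_le measurable_const
    ((measurable_birkhoffSum hT (measurable_one.indicator hV) N).const_mul _)

lemma measure_frequentVisitors_ne_zero [IsProbabilityMeasure μ] (hT : MeasurePreserving T μ μ)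
    (hV : MeasurableSet V) (hpos : μ V ≠ 0) : μ (frequentVisitors T V) ≠ 0 := by
  intro hzero
  have hc : 0 < μ.real V := ENNReal.toReal_pos hpos (measure_ne_top _ _)
  obtain ⟨k, hk⟩ := exists_nat_one_div_lt hc
  have hfi : Integrable (V.indicator (1 : α → ℝ)) μ :=
    (integrable_const (1 : ℝ)).indicator hV
  have key : 0 ≤ ∫ x, (1 / ((k : ℝ) + 1) - V.indicator (1 : α → ℝ) x) ∂μ := by
    refine integral_nonneg_of_ae_exists_birkhoffSum_pos hT
      (measurable_const.sub (measurable_one.indicator hV)) ((integrable_const _).sub hfi) ?_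
    filter_upwards [measure_eq_zero_iff_ae_notMem.mp hzero] with x hx
    simp only [frequentVisitors, Set.mem_ofPred_eq] at hx
    push Not at hx
    obtain ⟨N, -, hN⟩ := hx k 0
    refine ⟨N, ?_⟩
    have hsum : birkhoffSum T (fun x => 1 / ((k : ℝ) + 1) - V.indicator (1 : α → ℝ) x) N x
        = N * (1 / ((k : ℝ) + 1)) - birkhoffSum T (V.indicator (1 : α → ℝ)) N x := by
      simp [birkhoffSum]
    rw [hsum, sub_pos, mul_one_div, lt_div_iff₀ (by positivity), mul_comm]
    exact hN
  rw [integral_sub (integrable_const _) hfi, integral_indicator_one hV] at key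
  simp only [integral_const, probReal_univ, one_smul] at key
  linarith

end Visits

/-- If a bounded operator `A` on a separable infinite-dimensional Banach space admits an
invariant Borel probability measure `ν` with full support with respect to which it is
ergodic, then `ν`-almost every vector is frequently hypercyclic for `A`: for every
nonempty open `V`, the set of times `n` with `A^n z ∈ V` has positive lower density. -/
theorem frequently_hypercyclic_ae_of_ergodic {𝕜 : Type*} [NontriviallyNormedField 𝕜]
    {Z : Type*} [NormedAddCommGroup Z] [NormedSpace 𝕜 Z] [CompleteSpace Z]
    [TopologicalSpace.SeparableSpace Z] [MeasurableSpace Z] [BorelSpace Z]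
    (_hdim : ¬ FiniteDimensional 𝕜 Z)
    (A : Z →L[𝕜] Z) (ν : Measure Z) [IsProbabilityMeasure ν]
    (hinv : ∀ s : Set Z, MeasurableSet s → ν (⇑A ⁻¹' s) = ν s)
    (hfull : ∀ U : Set Z, IsOpen U → U.Nonempty → 0 < ν U)
    (herg : ∀ s : Set Z, MeasurableSet s → ⇑A ⁻¹' s = s → ν s * (1 - ν s) = 0) :
    ∀ᵐ z ∂ν, ∀ V : Set Z, IsOpen V → V.Nonempty →
      0 < Filter.atTop.liminf
        (fun N : ℕ => ({n : ℕ | n < N ∧ (A ^ n) z ∈ V}.ncard : ℝ) / N) := by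
  have : SecondCountableTopology Z := UniformSpace.secondCountable_of_separable Z
  have hA : MeasurePreserving A ν ν :=
    ⟨A.continuous.measurable, Measure.ext fun s hs => by
      rw [Measure.map_apply A.continuous.measurable hs, hinv s hs]⟩
  have hbasis : ∀ᵐ z ∂ν, ∀ b ∈ TopologicalSpace.countableBasis Z, z ∈ frequentVisitors A b := by
    rw [ae_ball_iff (TopologicalSpace.countable_countableBasis Z)]
    intro b hb
    have hbo := TopologicalSpace.isOpen_of_mem_countableBasis hb
    have hE := measurableSet_frequentVisitors hA.measurable hbo.measurableSet
    have hne := measure_frequentVisitors_ne_zero hA hbo.measurableSet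
      (hfull b hbo (TopologicalSpace.nonempty_of_mem_countableBasis hb)).ne'
    have h1 := (mul_eq_zero.mp (herg _ hE preimage_frequentVisitors)).resolve_left hne
    exact (mem_ae_iff_prob_eq_one hE).mpr (prob_le_one.antisymm (tsub_eq_zero_iff_le.mp h1))
  filter_upwards [hbasis] with z hz V hV hVne
  obtain ⟨v, hv⟩ := hVne
  obtain ⟨b, hb, -, hbV⟩ :=
    (TopologicalSpace.isBasis_countableBasis Z).exists_subset_of_mem_open hv hV
  simpa only [FunLike.coe_pow_eq_iterate] using
    liminf_visits_pos_of_mem_frequentVisitors hbV (hz b hb)
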